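/- Let C be a Pauli-Square-Root Clifford (PSC) and P a Pauli operator, both acting on a t-qubit register. Then, on one control qubit plus the register, C(P)·(I⊗C) = C(Q)·(I⊗C)·C(P), where Q = P C P† C† is a t-qubit Pauli operator that either commutes or anticommutes with C, and whose support is contained in the support of C. -/

import Mathlib

open Matrix Complex

noncomputable section

/-- An `n`-qubit operator: a matrix indexed by binary strings of length `n`. -/
abbrev QOp (n : ℕ) := Matrix (Fin n → Fin 2) (Fin n → Fin 2) ℂ

/-- The single-qubit Pauli `X` matrix. -/
def PauliX : Matrix (Fin 2) (Fin 2) ℂ := !![0, 1; 1, 0]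

/-- The single-qubit Pauli `Y` matrix. -/
def PauliY : Matrix (Fin 2) (Fin 2) ℂ := !![0, -Complex.I; Complex.I, 0]

/-- The single-qubit Pauli `Z` matrix. -/
def PauliZ : Matrix (Fin 2) (Fin 2) ℂ := !![1, 0; 0, -1]

/-- The tensor product of single-qubit operators, one per qubit. -/
def tensorOp {n : ℕ} (σ : Fin n → Matrix (Fin 2) (Fin 2) ℂ) : QOp n :=
  fun x y => ∏ i, σ i (x i) (y i)

/-- A matrix is unitary. -/
def IsUnitary {m : Type*} [Fintype m] [DecidableEq m] (U : Matrix m m ℂ) : Prop :=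
  U * Uᴴ = 1 ∧ Uᴴ * U = 1

/-- Membership in the `n`-qubit Pauli group: a phase in `{1, -1, i, -i}` times a
tensor product of single-qubit Pauli matrices (including the identity). -/
def IsPauli {n : ℕ} (P : QOp n) : Prop :=
  ∃ (γ : ℂ) (σ : Fin n → Matrix (Fin 2) (Fin 2) ℂ),
    (γ = 1 ∨ γ = -1 ∨ γ = Complex.I ∨ γ = -Complex.I) ∧
    (∀ i, σ i = 1 ∨ σ i = PauliX ∨ σ i = PauliY ∨ σ i = PauliZ) ∧
    P = γ • tensorOp σ

/-- An `n`-qubit Clifford unitary: conjugation preserves the Pauli group. -/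
def IsClifford {n : ℕ} (U : QOp n) : Prop :=
  IsUnitary U ∧ ∀ P : QOp n, IsPauli P → IsPauli (U * P * Uᴴ)

/-- The Clifford hierarchy: level 1 is the Pauli group; for `k ≥ 2`, level `k`
consists of the unitaries conjugating every Pauli into level `k - 1`. -/
def CliffordLevel {n : ℕ} : ℕ → QOp n → Prop
  | 0, _ => False
  | 1, V => IsPauli V
  | (k+2), V => IsUnitary V ∧ ∀ P : QOp n, IsPauli P → CliffordLevel (k+1) (V * P * Vᴴ)

/-- The controlled gate `C(U) = |0⟩⟨0| ⊗ I + |1⟩⟨1| ⊗ U`, with the control on qubit `0`. -/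
def controlled {n : ℕ} (U : QOp n) : QOp (n+1) :=
  fun x y =>
    if x 0 = y 0 then
      (if x 0 = 0 then (if Fin.tail x = Fin.tail y then 1 else 0)
       else U (Fin.tail x) (Fin.tail y))
    else 0

/-- The tensor product `a ⊗ A` of a single-qubit operator `a` (on the control qubit `0`)
with an `n`-qubit operator `A` (on the register). -/
def tensorWith {n : ℕ} (a : Matrix (Fin 2) (Fin 2) ℂ) (A : QOp n) : QOp (n+1) :=
  fun x y => a (x 0) (y 0) * A (Fin.tail x) (Fin.tail y)

/-- `A` acts trivially on qubit `i`: it is block-diagonal in the qubit-`i` basis and its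
entries do not depend on the (common) value of the `i`-th coordinate. -/
def actsTriviallyOn {n : ℕ} (A : QOp n) (i : Fin n) : Prop :=
  (∀ x y, x i ≠ y i → A x y = 0) ∧
  (∀ x y (c c' : Fin 2),
    A (Function.update x i c) (Function.update y i c) =
      A (Function.update x i c') (Function.update y i c'))

/-- The support of an operator: the set of qubits on which it acts nontrivially. -/
def Supp {n : ℕ} (A : QOp n) : Set (Fin n) := {i | ¬ actsTriviallyOn A i}

/-- A Pauli-Square-Root Clifford: a non-Pauli Clifford whose square is a Pauli. -/
def IsPSC {n : ℕ} (C : QOp n) : Prop := IsClifford C ∧ ¬ IsPauli C ∧ IsPauli (C * C)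

/-- Two operators either commute or anticommute. -/
def CommOrAnticomm {n : ℕ} (A B : QOp n) : Prop := A * B = B * A ∨ A * B = -(B * A)


lemma tensorOp_mul' {n : ℕ} (σ τ : Fin n → Matrix (Fin 2) (Fin 2) ℂ) :
    tensorOp σ * tensorOp τ = tensorOp (fun i => σ i * τ i) := by
  ext x y
  simp only [tensorOp, Matrix.mul_apply, ← Finset.prod_mul_distrib]
  rw [Finset.prod_univ_sum]
  simp

lemma tensorOp_smul' {n : ℕ} (c : Fin n → ℂ) (τ : Fin n → Matrix (Fin 2) (Fin 2) ℂ) :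
    tensorOp (fun i => c i • τ i) = (∏ i, c i) • tensorOp τ := by
  ext x y
  simp [tensorOp, Finset.prod_mul_distrib]

lemma tensorOp_one' {n : ℕ} : tensorOp (fun _ : Fin n => (1 : Matrix (Fin 2) (Fin 2) ℂ)) = 1 := by
  ext x y
  simp only [tensorOp, Matrix.one_apply]
  by_cases h : x = y
  · simp [h]
  · rw [if_neg h]
    obtain ⟨i, hi⟩ := Function.ne_iff.mp h
    exact Finset.prod_eq_zero (Finset.mem_univ i) (by simp [hi])

lemma tensorOp_conj' {n : ℕ} (σ : Fin n → Matrix (Fin 2) (Fin 2) ℂ) :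
    (tensorOp σ)ᴴ = tensorOp (fun i => (σ i)ᴴ) := by
  ext x y
  simp [tensorOp, Matrix.conjTranspose_apply]

def IsP1 (a : Matrix (Fin 2) (Fin 2) ℂ) : Prop := a = 1 ∨ a = PauliX ∨ a = PauliY ∨ a = PauliZ

lemma phase_iff (γ : ℂ) : (γ = 1 ∨ γ = -1 ∨ γ = Complex.I ∨ γ = -Complex.I) ↔ γ ^ 4 = 1 := by
  constructor
  · rintro (h | h | h | h) <;> subst h
    · simp
    · norm_num
    · simp
    · rw [Even.neg_pow (by decide)]; simp
  · intro h
    have : (γ - 1) * ((γ + 1) * ((γ - Complex.I) * (γ + Complex.I))) = 0 := by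
      linear_combination h - (γ^2-1) * Complex.I_sq
    rcases mul_eq_zero.mp this with h | h
    · left; linear_combination h
    rcases mul_eq_zero.mp h with h | h
    · right; left; linear_combination h
    rcases mul_eq_zero.mp h with h | h
    · right; right; left; linear_combination h
    · right; right; right; linear_combination h

lemma XY1 : PauliX * PauliY = Complex.I • PauliZ := by
  ext i j; fin_cases i <;> fin_cases j <;> simp [PauliX, PauliY, PauliZ]
lemma YX1 : PauliY * PauliX = (-Complex.I) • PauliZ := by
  ext i j; fin_cases i <;> fin_cases j <;> simp [PauliX, PauliY, PauliZ]
lemma YZ1 : PauliY * PauliZ = Complex.I • PauliX := by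
  ext i j; fin_cases i <;> fin_cases j <;> simp [PauliX, PauliY, PauliZ]
lemma ZY1 : PauliZ * PauliY = (-Complex.I) • PauliX := by
  ext i j; fin_cases i <;> fin_cases j <;> simp [PauliX, PauliY, PauliZ]
lemma ZX1 : PauliZ * PauliX = Complex.I • PauliY := by
  ext i j; fin_cases i <;> fin_cases j <;> simp [PauliX, PauliY, PauliZ]
lemma XZ1 : PauliX * PauliZ = (-Complex.I) • PauliY := by
  ext i j; fin_cases i <;> fin_cases j <;> simp [PauliX, PauliY, PauliZ]
lemma XX1 : PauliX * PauliX = 1 := by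
  ext i j; fin_cases i <;> fin_cases j <;> simp [PauliX]
lemma YY1 : PauliY * PauliY = 1 := by
  ext i j; fin_cases i <;> fin_cases j <;> simp [PauliY]
lemma ZZ1 : PauliZ * PauliZ = 1 := by
  ext i j; fin_cases i <;> fin_cases j <;> simp [PauliZ]

lemma IsP1.herm {a : Matrix (Fin 2) (Fin 2) ℂ} (h : IsP1 a) : aᴴ = a := by
  rcases h with h | h | h | h <;> subst h <;> ext i j <;> fin_cases i <;> fin_cases j <;>
    simp [PauliX, PauliY, PauliZ]

lemma IsP1.sq {a : Matrix (Fin 2) (Fin 2) ℂ} (h : IsP1 a) : a * a = 1 := by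
  rcases h with h | h | h | h <;> subst h <;> simp [XX1, YY1, ZZ1]

lemma IsP1.mul {a b : Matrix (Fin 2) (Fin 2) ℂ} (ha : IsP1 a) (hb : IsP1 b) :
    ∃ (γ : ℂ) (c : Matrix (Fin 2) (Fin 2) ℂ), γ ^ 4 = 1 ∧ IsP1 c ∧ a * b = γ • c := by
  have hI : (-Complex.I) ^ 4 = 1 := by rw [Even.neg_pow (by decide)]; simp
  rcases ha with h | h | h | h <;> rcases hb with h' | h' | h' | h' <;> subst h <;> subst h'
  · exact ⟨1, 1, by simp, by simp [IsP1], by simp⟩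
  · exact ⟨1, PauliX, by simp, by simp [IsP1], by simp⟩
  · exact ⟨1, PauliY, by simp, by simp [IsP1], by simp⟩
  · exact ⟨1, PauliZ, by simp, by simp [IsP1], by simp⟩
  · exact ⟨1, PauliX, by simp, by simp [IsP1], by simp⟩
  · exact ⟨1, 1, by simp, by simp [IsP1], by simp [XX1]⟩
  · exact ⟨_, _, by simp, by simp [IsP1], XY1⟩
  · exact ⟨_, _, hI, by simp [IsP1], XZ1⟩
  · exact ⟨1, PauliY, by simp, by simp [IsP1], by simp⟩
  · exact ⟨_, _, hI, by simp [IsP1], YX1⟩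
  · exact ⟨1, 1, by simp, by simp [IsP1], by simp [YY1]⟩
  · exact ⟨_, _, by simp, by simp [IsP1], YZ1⟩
  · exact ⟨1, PauliZ, by simp, by simp [IsP1], by simp⟩
  · exact ⟨_, _, by simp, by simp [IsP1], ZX1⟩
  · exact ⟨_, _, hI, by simp [IsP1], ZY1⟩
  · exact ⟨1, 1, by simp, by simp [IsP1], by simp [ZZ1]⟩

lemma IsP1.comm {a b : Matrix (Fin 2) (Fin 2) ℂ} (ha : IsP1 a) (hb : IsP1 b) :
    ∃ (γ : ℂ), γ ^ 2 = 1 ∧ a * b = γ • (b * a) := by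
  rcases ha with h | h | h | h <;> rcases hb with h' | h' | h' | h' <;> subst h <;> subst h' <;>
  first
  | (refine ⟨1, by simp, ?_⟩; simp; done)
  | (refine ⟨-1, by simp, ?_⟩; simp [XY1, YX1, YZ1, ZY1, XZ1, ZX1]; done)

lemma isPauli_iff {n : ℕ} (P : QOp n) : IsPauli P ↔
    ∃ (γ : ℂ) (σ : Fin n → Matrix (Fin 2) (Fin 2) ℂ),
      γ ^ 4 = 1 ∧ (∀ i, IsP1 (σ i)) ∧ P = γ • tensorOp σ := by
  unfold IsPauli
  simp only [phase_iff, IsP1]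

lemma IsPauli.mul' {n : ℕ} {P Q : QOp n} (hP : IsPauli P) (hQ : IsPauli Q) : IsPauli (P * Q) := by
  rw [isPauli_iff] at *
  obtain ⟨γ, σ, hγ, hσ, rfl⟩ := hP
  obtain ⟨δ, τ, hδ, hτ, rfl⟩ := hQ
  choose c ρ hc hρ h using fun i => (hσ i).mul (hτ i)
  refine ⟨γ * δ * ∏ i, c i, ρ, ?_, hρ, ?_⟩
  · rw [mul_pow, mul_pow, hγ, hδ, ← Finset.prod_pow]; simp [hc]
  · rw [smul_mul_smul_comm, tensorOp_mul', funext h, tensorOp_smul', smul_smul]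

lemma IsPauli.comm' {n : ℕ} {P Q : QOp n} (hP : IsPauli P) (hQ : IsPauli Q) :
    P * Q = Q * P ∨ P * Q = -(Q * P) := by
  rw [isPauli_iff] at *
  obtain ⟨γ, σ, hγ, hσ, rfl⟩ := hP
  obtain ⟨δ, τ, hδ, hτ, rfl⟩ := hQ
  choose c hc h using fun i => (hσ i).comm (hτ i)
  have h2 : (∏ i, c i) ^ 2 = 1 := by rw [← Finset.prod_pow]; simp [hc]
  have h3 : tensorOp σ * tensorOp τ = (∏ i, c i) • (tensorOp τ * tensorOp σ) := by
    rw [tensorOp_mul', funext h, tensorOp_smul', tensorOp_mul']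
  rw [smul_mul_smul_comm, smul_mul_smul_comm, h3, mul_comm δ γ]
  rcases (by simpa using h2 : (∏ i, c i) = 1 ∨ (∏ i, c i) = -1) with h | h <;> simp [h]

lemma IsPauli.conj_eq {n : ℕ} {P : QOp n} (hP : IsPauli P) : Pᴴ = P ∨ Pᴴ = -P := by
  obtain ⟨γ, σ, hγ, hσ, rfl⟩ := hP
  have : (tensorOp σ)ᴴ = tensorOp σ := by
    rw [tensorOp_conj', funext fun i => IsP1.herm (hσ i)]
  rw [conjTranspose_smul, this]
  rcases hγ with h | h | h | h <;> subst h <;> simp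

lemma IsPauli.neg' {n : ℕ} {P : QOp n} (hP : IsPauli P) : IsPauli (-P) := by
  rw [isPauli_iff] at *
  obtain ⟨γ, σ, hγ, hσ, rfl⟩ := hP
  exact ⟨-γ, σ, by rw [Even.neg_pow (by decide), hγ], hσ, by simp⟩

lemma IsPauli.conj' {n : ℕ} {P : QOp n} (hP : IsPauli P) : IsPauli Pᴴ := by
  rcases hP.conj_eq with h | h <;> rw [h]
  · exact hP
  · exact hP.neg'

lemma IsPauli.mul_conj {n : ℕ} {P : QOp n} (hP : IsPauli P) : P * Pᴴ = 1 := by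
  obtain ⟨γ, σ, hγ, hσ, rfl⟩ := hP
  have : tensorOp σ * (tensorOp σ)ᴴ = 1 := by
    rw [tensorOp_conj', tensorOp_mul', ← tensorOp_one']
    congr 1; funext i
    rw [IsP1.herm (hσ i), IsP1.sq (hσ i)]
  rw [conjTranspose_smul, smul_mul_smul_comm, this]
  rcases hγ with h | h | h | h <;> subst h <;> simp

lemma IsPauli.conj_mul {n : ℕ} {P : QOp n} (hP : IsPauli P) : Pᴴ * P = 1 :=
  mul_eq_one_comm.mp hP.mul_conj

/-- a single-qubit operator on qubit `i` -/
def loc {n : ℕ} (i : Fin n) (a : Matrix (Fin 2) (Fin 2) ℂ) : QOp n :=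
  tensorOp (Function.update (fun _ => 1) i a)

lemma loc_pauli {n : ℕ} (i : Fin n) {a : Matrix (Fin 2) (Fin 2) ℂ} (ha : IsP1 a) :
    IsPauli (loc i a) := by
  rw [isPauli_iff]
  refine ⟨1, _, by simp, fun j => ?_, (one_smul _ _).symm⟩
  by_cases h : j = i
  · subst h; simpa using ha
  · simp [h, IsP1]

lemma loc_apply {n : ℕ} (i : Fin n) (a : Matrix (Fin 2) (Fin 2) ℂ) (x y : Fin n → Fin 2) :
    loc i a x y = if Function.update x i (y i) = y then a (x i) (y i) else 0 := by
  unfold loc tensorOp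
  split_ifs with h
  · rw [Finset.prod_eq_single i]
    · simp
    · intro j _ hj
      have := congrFun h j
      simp [hj] at this
      simp [hj, this]
    · simp
  · obtain ⟨j, hj⟩ := Function.ne_iff.mp h
    have hji : j ≠ i := by rintro rfl; simp at hj
    refine Finset.prod_eq_zero (Finset.mem_univ j) ?_
    simp [hji] at hj ⊢
    simp [hj]

lemma loc_mul_apply {n : ℕ} (i : Fin n) (a : Matrix (Fin 2) (Fin 2) ℂ) (A : QOp n)
    (x y : Fin n → Fin 2) :
    (loc i a * A) x y = ∑ c, a (x i) c * A (Function.update x i c) y := by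
  rw [Matrix.mul_apply]
  simp only [loc_apply]
  rw [← Finset.sum_filter_add_sum_filter_not _ (fun z => Function.update x i (z i) = z)]
  rw [add_eq_left.mpr]
  · symm
    refine Finset.sum_bij (fun c _ => Function.update x i c) ?_ ?_ ?_ ?_
    · intro c _; simp
    · intro c _ c' _ h; simpa using congrFun h i
    · intro z hz; exact ⟨z i, by simp, by simpa using hz⟩
    · intro c _; simp
  · refine Finset.sum_eq_zero fun z hz => ?_
    simp at hz; simp [hz]

lemma mul_loc_apply {n : ℕ} (i : Fin n) (a : Matrix (Fin 2) (Fin 2) ℂ) (A : QOp n)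
    (x y : Fin n → Fin 2) :
    (A * loc i a) x y = ∑ c, A x (Function.update y i c) * a c (y i) := by
  have hs : ∀ z, loc i a z y = if Function.update y i (z i) = z then a (z i) (y i) else 0 := by
    intro z
    rw [loc_apply]
    congr 1
    apply propext
    constructor
    · intro h; rw [← h]; simp
    · intro h; rw [← h]; simp
  rw [Matrix.mul_apply]
  simp only [hs]
  rw [← Finset.sum_filter_add_sum_filter_not _ (fun z => Function.update y i (z i) = z)]
  rw [add_eq_left.mpr]
  · symm
    refine Finset.sum_bij (fun c _ => Function.update y i c) ?_ ?_ ?_ ?_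
    · intro c _; simp
    · intro c _ c' _ h; simpa using congrFun h i
    · intro z hz; exact ⟨z i, by simp, by simpa using hz⟩
    · intro c _; simp
  · refine Finset.sum_eq_zero fun z hz => ?_
    simp at hz; simp [hz]

lemma triv_of_comm {n : ℕ} {A : QOp n} {i : Fin n} (hX : loc i PauliX * A = A * loc i PauliX)
    (hZ : loc i PauliZ * A = A * loc i PauliZ) : actsTriviallyOn A i := by
  constructor
  · intro x y hxy
    have h := congrFun (congrFun hZ x) y
    rw [loc_mul_apply, mul_loc_apply] at h
    have e1 : ∀ p, x i = p → Function.update x i p = x := by rintro p rfl; simp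
    have e2 : ∀ p, y i = p → Function.update y i p = y := by rintro p rfl; simp
    generalize hx : x i = p at *
    generalize hy : y i = q at *
    fin_cases p <;> fin_cases q <;> simp [PauliZ] at h hxy e1 e2 <;> rw [e1, e2, Function.update_eq_self, Function.update_eq_self] at h
    · linear_combination h / 2
    · linear_combination - h / 2
  · have key : ∀ x y, A (Function.update x i 0) (Function.update y i 0) =
      A (Function.update x i 1) (Function.update y i 1) := by
      intro x y
      have h := congrFun (congrFun hX (Function.update x i 1)) (Function.update y i 0)
      rw [loc_mul_apply, mul_loc_apply] at h
      simpa [PauliX] using h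
    intro x y c c'
    fin_cases c <;> fin_cases c' <;> simp [key]

lemma comm_of_triv {n : ℕ} {A : QOp n} {i : Fin n} (h : actsTriviallyOn A i)
    (a : Matrix (Fin 2) (Fin 2) ℂ) : loc i a * A = A * loc i a := by
  ext x y
  rw [loc_mul_apply, mul_loc_apply]
  rw [Finset.sum_eq_single (y i), Finset.sum_eq_single (x i)]
  · have := h.2 x y (x i) (y i)
    simp only [Function.update_eq_self] at this
    rw [this, mul_comm]
  · intro c _ hc
    rw [h.1 _ _ (by simpa using hc.symm), zero_mul]
  · simp
  · intro c _ hc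
    rw [h.1 _ _ (by simpa using hc), mul_zero]
  · simp

lemma comm_aux {n : ℕ} {C P L : QOp n} (hU : IsUnitary C) (hP : IsPauli P) (hL : IsPauli L)
    (h : L * C = C * L) : L * (P * C * Pᴴ * Cᴴ) = (P * C * Pᴴ * Cᴴ) * L := by
  have h1 : L * Cᴴ = Cᴴ * L := by
    calc L * Cᴴ = (Cᴴ * C) * L * Cᴴ := by rw [hU.2, one_mul]
      _ = Cᴴ * (L * C) * Cᴴ := by rw [h]; simp only [mul_assoc]
      _ = Cᴴ * L * (C * Cᴴ) := by simp only [mul_assoc]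
      _ = Cᴴ * L := by rw [hU.1, mul_one]
  have hPP := hP.mul_conj
  have hPP' := hP.conj_mul
  have h2 : L * (P * C * Pᴴ) = (P * C * Pᴴ) * L := by
    rcases hP.conj_eq with e | e <;> rw [e] <;> rcases hL.comm' hP with h' | h'
    · calc L * (P * C * P) = (L * P) * C * P := by simp only [mul_assoc]
        _ = P * (L * C) * P := by rw [h']; simp only [mul_assoc]
        _ = P * C * (L * P) := by rw [h]; simp only [mul_assoc]
        _ = _ := by rw [h']; simp only [mul_assoc]
    · calc L * (P * C * P) = (L * P) * C * P := by simp only [mul_assoc]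
        _ = -(P * (L * C) * P) := by rw [h']; simp only [mul_assoc, neg_mul]
        _ = -(P * C * (L * P)) := by rw [h]; simp only [mul_assoc]
        _ = _ := by rw [h']; simp only [mul_assoc, mul_neg, neg_neg]
    · simp only [mul_neg, neg_mul, neg_inj]
      calc L * (P * C * P) = (L * P) * C * P := by simp only [mul_assoc]
        _ = P * (L * C) * P := by rw [h']; simp only [mul_assoc]
        _ = P * C * (L * P) := by rw [h]; simp only [mul_assoc]
        _ = _ := by rw [h']; simp only [mul_assoc]
    · simp only [mul_neg, neg_mul, neg_inj]
      calc L * (P * C * P) = (L * P) * C * P := by simp only [mul_assoc]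
        _ = -(P * (L * C) * P) := by rw [h']; simp only [mul_assoc, neg_mul]
        _ = -(P * C * (L * P)) := by rw [h]; simp only [mul_assoc]
        _ = _ := by rw [h']; simp only [mul_assoc, mul_neg, neg_neg]
  rw [← mul_assoc, h2, mul_assoc, h1, ← mul_assoc]

/-- block diagonal operator -/
def blk {n : ℕ} (A B : QOp n) : QOp (n+1) := fun x y =>
  if x 0 = y 0 then (if x 0 = 0 then A (Fin.tail x) (Fin.tail y) else B (Fin.tail x) (Fin.tail y))
  else 0

lemma blk_mul {n : ℕ} (A B A' B' : QOp n) : blk A B * blk A' B' = blk (A * A') (B * B') := by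
  ext x y
  rw [Matrix.mul_apply, ← (Fin.consEquiv (fun _ : Fin (n+1) => Fin 2)).sum_comp,
    Fintype.sum_prod_type]
  simp only [blk, Fin.consEquiv_apply, Fin.cons_zero, Fin.sum_univ_two,
    Matrix.mul_apply]
  generalize x 0 = p
  generalize y 0 = q
  fin_cases p <;> fin_cases q <;> simp <;> rfl

lemma controlled_blk {n : ℕ} (U : QOp n) : controlled U = blk 1 U := by
  ext x y; simp [controlled, blk, Matrix.one_apply]

lemma tensorWith_blk {n : ℕ} (U : QOp n) : tensorWith 1 U = blk U U := by
  ext x y; simp [tensorWith, blk, Matrix.one_apply]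

/-- For a PSC `C` and a Pauli `P` on `t` qubits,
`C(P)·(I⊗C) = C(Q)·(I⊗C)·C(P)` where `Q = P C P† C†` is a Pauli that either commutes or
anticommutes with `C` and whose support is contained in that of `C`. -/
theorem controlled_pauli_prop_psc {t : ℕ} (C P : QOp t) (hC : IsPSC C) (hP : IsPauli P) :
    IsPauli (P * C * Pᴴ * Cᴴ) ∧
    CommOrAnticomm (P * C * Pᴴ * Cᴴ) C ∧
    Supp (P * C * Pᴴ * Cᴴ) ⊆ Supp C ∧
    controlled P * tensorWith 1 C =
      controlled (P * C * Pᴴ * Cᴴ) * (tensorWith 1 C * controlled P) := by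
  obtain ⟨⟨hU, hCl⟩, -, hR⟩ := hC
  have hQ : IsPauli (P * C * Pᴴ * Cᴴ) := by
    have := hP.mul' (hCl _ hP.conj')
    simpa only [mul_assoc] using this
  have hQC : P * C * Pᴴ * Cᴴ * C = P * C * Pᴴ := by rw [mul_assoc, hU.2, mul_one]
  refine ⟨hQ, ?_, ?_, ?_⟩
  · generalize P * C * Pᴴ * Cᴴ = Q at *
    have h1 : Q * C * (Q * C) = P * (C * C) * Pᴴ := by
      rw [hQC]
      calc P * C * Pᴴ * (P * C * Pᴴ) = P * C * (Pᴴ * P) * C * Pᴴ := by simp only [mul_assoc]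
        _ = _ := by rw [hP.conj_mul]; simp only [mul_assoc, mul_one]
    have h2 : Q * C * (Q * C) = C * C ∨ Q * C * (Q * C) = -(C * C) := by
      rw [h1]
      rcases hP.comm' hR with h | h <;> rw [h]
      · left; rw [mul_assoc, hP.mul_conj, mul_one]
      · right; rw [neg_mul, mul_assoc, hP.mul_conj, mul_one]
    have h3 : Q * C * (Q * C) * (Cᴴ * Qᴴ) = Q * C := by
      calc _ = Q * C * (Q * (C * Cᴴ) * Qᴴ) := by simp only [mul_assoc]
        _ = _ := by rw [hU.1, mul_one, hQ.mul_conj, mul_one]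
    have h4 : C * C * (Cᴴ * Qᴴ) = C * Qᴴ := by
      calc _ = C * (C * Cᴴ) * Qᴴ := by simp only [mul_assoc]
        _ = _ := by rw [hU.1, mul_one]
    unfold CommOrAnticomm
    rw [← h3]
    rcases h2 with h | h <;> rw [h] <;> rcases hQ.conj_eq with e | e <;>
      simp only [neg_mul, h4] <;> rw [e] <;> simp
  · intro i hi hC
    exact hi (triv_of_comm
      (comm_aux hU hP (loc_pauli i (by simp [IsP1])) (comm_of_triv hC _))
      (comm_aux hU hP (loc_pauli i (by simp [IsP1])) (comm_of_triv hC _)))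
  · rw [controlled_blk, controlled_blk, tensorWith_blk, blk_mul, blk_mul, blk_mul]
    congr 1
    · simp
    · rw [← mul_assoc, hQC, mul_assoc, hP.conj_mul, mul_one]

end
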